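/- arXiv:1907.00421 — 2 statements merged into one kernel-verified Lean document; each statement's English description precedes it below -/
import Mathlib

section
/- Let M₁ = (P,p₀,δ₁) and M₂ = (Q,q₀,δ₂) be two communicating machines and let ℛ be an asynchronous subtyping relation with (p₀,q₀) ∈ ℛ. Then for every node n of the simulation tree simtree(M₁,M₂), if ℒ(n) = (p,T) then (p,T) ∈ ℛ. Consequently, every node of simtree(M₁,M₂) is either labelled by a pair (p,q) of final states or has a successor, so no branch of simtree(M₁,M₂) is unsuccessful. -/
namespace AsyncSession

/-- Actions: send `!a` or receive `?a` over an alphabet `A`. -/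
inductive Act (A : Type) : Type
  | send : A → Act A
  | recv : A → Act A

/-- Direction of an action: `true` for send, `false` for receive. -/
def Act.dir {A : Type} : Act A → Bool
  | .send _ => true
  | .recv _ => false

/-- A (deterministic, directed) communicating machine with states `S`
    over alphabet `A`. -/
structure Machine (A S : Type) where
  init : S
  trans : S → Act A → S → Prop
  directed : ∀ q ℓ q' ℓ' q'', trans q ℓ q' → trans q ℓ' q'' → Act.dir ℓ = Act.dir ℓ'
  deterministic : ∀ q ℓ q' q'', trans q ℓ q' → trans q ℓ q'' → q' = q''

variable {A P Q S V W' : Type}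

/-- A state is final iff it has no outgoing transitions. -/
def Machine.Final (M : Machine A S) (q : S) : Prop := ∀ ℓ q', ¬ M.trans q ℓ q'

/-- A state is sending iff it is not final and all its transitions are sends. -/
def Machine.Sending (M : Machine A S) (q : S) : Prop :=
  ¬ M.Final q ∧ ∀ ℓ q', M.trans q ℓ q' → Act.dir ℓ = true

/-- A state is receiving iff it is not final and all its transitions are receives. -/
def Machine.Receiving (M : Machine A S) (q : S) : Prop :=
  ¬ M.Final q ∧ ∀ ℓ q', M.trans q ℓ q' → Act.dir ℓ = false

/-- `in(q)`: messages receivable at `q`. -/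
def Machine.inSet (M : Machine A S) (q : S) : Set A := {a | ∃ q', M.trans q (.recv a) q'}

/-- `out(q)`: messages sendable at `q`. -/
def Machine.outSet (M : Machine A S) (q : S) : Set A := {a | ∃ q', M.trans q (.send a) q'}

/-- Multi-step transition along a list of actions. -/
inductive ActPath (M : Machine A S) : S → List (Act A) → S → Prop
  | nil (q : S) : ActPath M q [] q
  | cons {q : S} {ℓ : Act A} {q₁ : S} {ψ : List (Act A)} {q' : S} :
      M.trans q ℓ q₁ → ActPath M q₁ ψ q' → ActPath M q (ℓ :: ψ) q'

/-- `cycle(!,q)`: a cycle of send actions is reachable from `q` via sends. -/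
def SendCycle (M : Machine A S) (q : S) : Prop :=
  ∃ (ω ω' : List A) (q' : S),
    ActPath M q (ω.map Act.send) q' ∧ ω' ≠ [] ∧ ActPath M q' (ω'.map Act.send) q'

/-- Input trees over alphabet `A` and states `S`: either a single state (a hole
filled with a state), or a nonempty finite input branching `⟨a_i : T_i⟩`. -/
inductive ITree (A S : Type) : Type
  | leaf : S → ITree A S
  | node : (dom : Finset A) → dom.Nonempty → ((a : A) → a ∈ dom → ITree A S) → ITree A S

/-- The set of states occurring at the leaves of an input tree (equivalently, the
states in the holes of the corresponding input context). -/
def ITree.leaves : ITree A S → Set S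
  | .leaf q => {q}
  | .node dom _ f => {s | ∃ (a : A) (h : a ∈ dom), s ∈ (f a h).leaves}

/-- `minHeight`: the length of a shortest root-to-leaf (root-to-hole) path. -/
noncomputable def ITree.minHeight : ITree A S → ℕ
  | .leaf _ => 0
  | .node dom _ f => 1 + sInf {h | ∃ (a : A) (ha : a ∈ dom), (f a ha).minHeight = h}
termination_by structural t => t

open Classical in
/-- `extract(𝒜,ω)`: follow the word `ω` of input messages down the tree. -/
noncomputable def ITree.extract : ITree A S → List A → Option (ITree A S)
  | t, [] => some t
  | .leaf _, _ :: _ => none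
  | .node dom _ f, a :: ω => if h : a ∈ dom then (f a h).extract ω else none
termination_by structural t => t

/-- Replace every leaf `q` of a tree by some tree `t` with `R q t`
(filling of an input context, relationally). -/
inductive ReplaceLeaves (R : S → ITree A S → Prop) : ITree A S → ITree A S → Prop
  | leaf {q : S} {t : ITree A S} : R q t → ReplaceLeaves R (.leaf q) t
  | node {dom : Finset A} {hne : dom.Nonempty} {f g : (a : A) → a ∈ dom → ITree A S} :
      (∀ a (h : a ∈ dom), ReplaceLeaves R (f a h) (g a h)) →
      ReplaceLeaves R (.node dom hne f) (.node dom hne g)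

/-- `InTree M q T` holds iff `inTree(q)` is defined and equals `T`. -/
inductive InTree (M : Machine A S) : S → ITree A S → Prop
  | leaf {q : S} : M.inSet q = ∅ → InTree M q (.leaf q)
  | node {q : S} {dom : Finset A} {hne : dom.Nonempty}
      {f : (a : A) → a ∈ dom → ITree A S} :
      (↑dom : Set A) = M.inSet q →
      (∀ a (h : a ∈ dom), ∀ q', M.trans q (.recv a) q' → InTree M q' (f a h)) →
      InTree M q (.node dom hne f)

/-- `AccTree M ω q t` holds iff `accTree(q,ω)` is defined and equals `t`. -/
def AccTree (M : Machine A S) : List A → S → ITree A S → Prop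
  | [], q, t => t = .leaf q
  | a :: ω, q, t =>
      ∃ T, InTree M q T ∧
        ReplaceLeaves (fun p t' => ∃ p', M.trans p (.send a) p' ∧ AccTree M ω p' t') T t

/-- `rcv(ψ)`: the messages of the receive actions in `ψ`, in order. -/
def rcvWord (ψ : List (Act A)) : List A :=
  ψ.filterMap fun ℓ => match ℓ with | .recv a => some a | .send _ => none

/-- `snd(ψ)`: the messages of the send actions in `ψ`, in order. -/
def sndWord (ψ : List (Act A)) : List A :=
  ψ.filterMap fun ℓ => match ℓ with | .send a => some a | .recv _ => none

/-- `MinAcc M ψ k Qs r` holds iff `minAcc(k,Qs,ψ)` is defined and equals `r`. -/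
def MinAcc (M : Machine A S) : List (Act A) → ℕ → Set S → ℕ → Prop
  | [], k, _, r => r = k
  | .recv _ :: ψ, k, Qs, r => 0 < k ∧ MinAcc M ψ (k - 1) Qs r
  | .send a :: ψ, k, Qs, r =>
      Qs.Nonempty ∧
      ∃ T : S → ITree A S,
        (∀ q ∈ Qs, AccTree M [a] q (T q)) ∧
        MinAcc M ψ (k + sInf {h | ∃ q ∈ Qs, (T q).minHeight = h})
          {q' | ∃ q ∈ Qs, q' ∈ (T q).leaves} r

/-- One step of the asynchronous subtyping simulation game, on configurations
`(p,T)` with `p` a state of `M₁` and `T` an input tree over the states of `M₂`.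
The four rules are (In), (Out), (InCtx) and (OutAcc). -/
inductive Step (M1 : Machine A P) (M2 : Machine A Q) :
    P × ITree A Q → Act A → P × ITree A Q → Prop
  | inp {p : P} {q : Q} {a : A} {p' : P} {q' : Q} :
      M1.trans p (.recv a) p' → M2.trans q (.recv a) q' →
      M2.inSet q ⊆ M1.inSet p →
      Step M1 M2 (p, .leaf q) (.recv a) (p', .leaf q')
  | out {p : P} {q : Q} {a : A} {p' : P} {q' : Q} :
      M1.trans p (.send a) p' → M2.trans q (.send a) q' →
      M1.outSet p ⊆ M2.outSet q →
      Step M1 M2 (p, .leaf q) (.send a) (p', .leaf q')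
  | inCtx {p : P} {a : A} {p' : P} {dom : Finset A} {hne : dom.Nonempty}
      {f : (b : A) → b ∈ dom → ITree A Q} (h : a ∈ dom) :
      M1.trans p (.recv a) p' → (↑dom : Set A) ⊆ M1.inSet p →
      Step M1 M2 (p, .node dom hne f) (.recv a) (p', f a h)
  | outAcc {p : P} {a : A} {p' : P} {T T' : ITree A Q} :
      M1.trans p (.send a) p' → ¬ SendCycle M1 p →
      ReplaceLeaves (fun q t => ∃ U, InTree M2 q U ∧
          ReplaceLeaves (fun qh t' => M1.outSet p ⊆ M2.outSet qh ∧
              ∃ q', M2.trans qh (.send a) q' ∧ t' = .leaf q') U t) T T' →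
      Step M1 M2 (p, T) (.send a) (p', T')

/-- The root configuration of the simulation tree. -/
def initConfig (M1 : Machine A P) (M2 : Machine A Q) : P × ITree A Q :=
  (M1.init, .leaf M2.init)

def StepAny (M1 : Machine A P) (M2 : Machine A Q) (c c' : P × ITree A Q) : Prop :=
  ∃ ℓ, Step M1 M2 c ℓ c'

/-- Configurations reachable from the root, i.e. the labels of the nodes of
the simulation tree `simtree(M₁,M₂)`. -/
def CReach (M1 : Machine A P) (M2 : Machine A Q) (c : P × ITree A Q) : Prop :=
  Relation.ReflTransGen (StepAny M1 M2) (initConfig M1 M2) c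

/-- A successful leaf: a pair of final states with empty input context. -/
def SuccessfulConfig (M1 : Machine A P) (M2 : Machine A Q) (c : P × ITree A Q) : Prop :=
  ∃ p q, c = (p, ITree.leaf q) ∧ M1.Final p ∧ M2.Final q

/-- All branches of `simtree(M₁,M₂)` are successful: every branch is infinite or
ends in a successful leaf, i.e. every reachable node without successors is a
successful leaf. -/
def AllBranchesSuccessful (M1 : Machine A P) (M2 : Machine A Q) : Prop :=
  ∀ c, CReach M1 M2 c → (∀ ℓ c', ¬ Step M1 M2 c ℓ c') → SuccessfulConfig M1 M2 c

/-- Asynchronous subtyping relations (Definition of asynchronous subtyping). -/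
def IsSubtypingRel (M1 : Machine A P) (M2 : Machine A Q)
    (R : P → ITree A Q → Prop) : Prop :=
  ∀ p T, R p T →
    (M1.Final p → ∃ q, T = ITree.leaf q ∧ M2.Final q) ∧
    (M1.Receiving p →
      (∀ q, T = ITree.leaf q →
        M2.Receiving q ∧
        ∀ a q', M2.trans q (.recv a) q' →
          ∃ p', M1.trans p (.recv a) p' ∧ R p' (ITree.leaf q')) ∧
      (∀ (dom : Finset A) (hne : dom.Nonempty) (f : (a : A) → a ∈ dom → ITree A Q),
        T = ITree.node dom hne f →
        ∀ a (h : a ∈ dom), ∃ p', M1.trans p (.recv a) p' ∧ R p' (f a h))) ∧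
    (M1.Sending p →
      (∀ q, T = ITree.leaf q → M2.Sending q →
        ∀ a p', M1.trans p (.send a) p' →
          ∃ q', M2.trans q (.send a) q' ∧ R p' (ITree.leaf q')) ∧
      ((¬ ∃ q, T = ITree.leaf q ∧ M2.Sending q) →
        ¬ SendCycle M1 p ∧
        (∀ q ∈ T.leaves, ∃ U, InTree M2 q U) ∧
        (∀ a p', M1.trans p (.send a) p' →
          ∃ T', ReplaceLeaves (fun q t => ∃ U, InTree M2 q U ∧
              ReplaceLeaves (fun qh t' => ∃ q', M2.trans qh (.send a) q' ∧
                  t' = ITree.leaf q') U t) T T' ∧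
            R p' T')))

/-- `M₁ ≤ M₂`: asynchronous session subtyping. -/
def Subtyping (M1 : Machine A P) (M2 : Machine A Q) : Prop :=
  ∃ R, IsSubtypingRel M1 M2 R ∧ R M1.init (ITree.leaf M2.init)

/-! ### Nodes of the simulation tree and (candidate/witness) subtrees -/

/-- A node of the simulation tree: the sequence of edge labels from the root
together with the configuration labelling the node. -/
abbrev SNode (A P Q : Type) := List (Act A) × (P × ITree A Q)

/-- The root node of the simulation tree. -/
def rootNode (M1 : Machine A P) (M2 : Machine A Q) : SNode A P Q :=
  ([], initConfig M1 M2)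

/-- Labelled edges of the simulation tree. -/
def Edge (M1 : Machine A P) (M2 : Machine A Q)
    (n : SNode A P Q) (ℓ : Act A) (n' : SNode A P Q) : Prop :=
  n'.1 = n.1 ++ [ℓ] ∧ Step M1 M2 n.2 ℓ n'.2

def EdgeAny (M1 : Machine A P) (M2 : Machine A Q) (n n' : SNode A P Q) : Prop :=
  ∃ ℓ, Edge M1 M2 n ℓ n'

/-- `n ↝* n'`. -/
def NReach (M1 : Machine A P) (M2 : Machine A Q) : SNode A P Q → SNode A P Q → Prop :=
  Relation.ReflTransGen (EdgeAny M1 M2)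

/-- `n ↝⁺ n'`. -/
def NReachPlus (M1 : Machine A P) (M2 : Machine A Q) : SNode A P Q → SNode A P Q → Prop :=
  Relation.TransGen (EdgeAny M1 M2)

/-- `n ↝^ψ n'`: path with label sequence `ψ`. -/
inductive EdgePath (M1 : Machine A P) (M2 : Machine A Q) :
    SNode A P Q → List (Act A) → SNode A P Q → Prop
  | nil (n : SNode A P Q) : EdgePath M1 M2 n [] n
  | cons {n : SNode A P Q} {ℓ : Act A} {n₁ : SNode A P Q} {ψ : List (Act A)}
      {n' : SNode A P Q} :
      Edge M1 M2 n ℓ n₁ → EdgePath M1 M2 n₁ ψ n' → EdgePath M1 M2 n (ℓ :: ψ) n'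

/-- Data of a subtree of the simulation tree: a root `r`, a boundary `B`, and an
ancestor function `anc` (only its values on `B` matter). -/
structure SubtreeData (A P Q : Type) where
  r : SNode A P Q
  B : Set (SNode A P Q)
  anc : SNode A P Q → SNode A P Q

/-- `nodes(r,B)`: the nodes of the finite subtree. -/
def SubtreeData.nodes (W : SubtreeData A P Q) (M1 : Machine A P) (M2 : Machine A Q) :
    Set (SNode A P Q) :=
  {n | NReach M1 M2 W.r n ∧ ∃ b ∈ W.B, NReach M1 M2 n b}

/-- `(r,B)` is a finite subtree of `simtree(M₁,M₂)`. -/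
def SubtreeData.IsFiniteSubtree (W : SubtreeData A P Q)
    (M1 : Machine A P) (M2 : Machine A Q) : Prop :=
  NReach M1 M2 (rootNode M1 M2) W.r ∧
  W.B.Finite ∧
  (∀ n ∈ W.B, NReach M1 M2 W.r n) ∧
  (∀ n ∈ W.B, ∀ n' ∈ W.B, ¬ NReachPlus M1 M2 n n') ∧
  (∀ n, NReach M1 M2 W.r n → ∃ n' ∈ W.B, NReach M1 M2 n n' ∨ NReach M1 M2 n' n)

/-- `(r,B,anc)` is a candidate subtree of `simtree(M₁,M₂)`. -/
def SubtreeData.IsCandidate (W : SubtreeData A P Q)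
    (M1 : Machine A P) (M2 : Machine A Q) : Prop :=
  W.IsFiniteSubtree M1 M2 ∧
  ∀ n ∈ W.B,
    W.anc n ∈ W.nodes M1 M2 \ W.B ∧
    NReachPlus M1 M2 (W.anc n) n ∧
    n.2.1 = (W.anc n).2.1 ∧
    (n.2.2).leaves ⊆ ((W.anc n).2.2).leaves

/-- `tr(n)`: `n` itself if it is not a boundary node, its ancestor otherwise. -/
noncomputable def SubtreeData.tr (W : SubtreeData A P Q) (n : SNode A P Q) : SNode A P Q := by
  classical exact if n ∈ W.B then W.anc n else n

/-! ### Input tree expressions, systems of input tree equations, compatibility -/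

/-- Input tree expressions over alphabet `A` and variables `V`:
variables, input choices, and silent choices. -/
inductive ITExpr (A V : Type) : Type
  | var : V → ITExpr A V
  | inp : (dom : Finset A) → dom.Nonempty → ((a : A) → a ∈ dom → ITExpr A V) → ITExpr A V
  | sil : ITExpr A V → List (ITExpr A V) → ITExpr A V

/-- Turn an input tree into an input tree expression by replacing each leaf
state `q` by the variable `v q`. -/
def ITree.toExprVar : ITree A S → (S → V) → ITExpr A V
  | .leaf q, v => .var (v q)
  | .node dom hne f, v => .inp dom hne fun a h => (f a h).toExprVar v

/-- Relational version: replace each leaf `q` by some expression `e` with `R q e`. -/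
inductive ToExpr (R : S → ITExpr A V → Prop) : ITree A S → ITExpr A V → Prop
  | leaf {q : S} {e : ITExpr A V} : R q e → ToExpr R (.leaf q) e
  | node {dom : Finset A} {hne : dom.Nonempty} {f : (a : A) → a ∈ dom → ITree A S}
      {g : (a : A) → a ∈ dom → ITExpr A V} :
      (∀ a (h : a ∈ dom), ToExpr R (f a h) (g a h)) →
      ToExpr R (.node dom hne f) (.inp dom hne g)

/-- Compatibility relations between two systems of input tree equations, given by
their definition maps `defL` and `defR`. -/
def IsCompatRel (defL : V → ITExpr A V) (defR : W' → ITExpr A W')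
    (R : ITExpr A V → ITExpr A W' → Prop) : Prop :=
  (∀ (X : V) (E : ITExpr A W'), R (.var X) E → R (defL X) E) ∧
  (∀ (E : ITExpr A V) (X : W'), R E (.var X) → R E (defR X)) ∧
  (∀ (e₀ : ITExpr A V) (es : List (ITExpr A V)) (E : ITExpr A W'),
      R (.sil e₀ es) E → ∀ e ∈ e₀ :: es, R e E) ∧
  (∀ (E : ITExpr A V) (e₀ : ITExpr A W') (es : List (ITExpr A W')),
      R E (.sil e₀ es) → ∀ e ∈ e₀ :: es, R E e) ∧
  (∀ (dom : Finset A) (hne : dom.Nonempty) (f : (a : A) → a ∈ dom → ITExpr A V)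
      (dom' : Finset A) (hne' : dom'.Nonempty) (g : (a : A) → a ∈ dom' → ITExpr A W'),
      R (.inp dom hne f) (.inp dom' hne' g) →
      dom ⊆ dom' ∧ ∀ a (h : a ∈ dom) (h' : a ∈ dom'), R (f a h) (g a h'))

/-- `E ⊑ E'`: compatibility of two expressions w.r.t. the definition maps. -/
def Compat (defL : V → ITExpr A V) (defR : W' → ITExpr A W')
    (E : ITExpr A V) (E' : ITExpr A W') : Prop :=
  ∃ R, IsCompatRel defL defR R ∧ R E E'

/-- Specification of the system `𝒢` of condition (3a) of the witness-subtree
definition: variables are `X₀` (`none`) and `X_{q,n}` (`some (q,n)`). -/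
def GSpec (M1 : Machine A P) (M2 : Machine A Q) (W : SubtreeData A P Q)
    (EG : Option (Q × SNode A P Q) → ITExpr A (Option (Q × SNode A P Q))) : Prop :=
  ToExpr (fun q e => e = .var (some (q, W.r))) (W.r.2.2) (EG none) ∧
  ∀ (q : Q), ∀ n ∈ W.nodes M1 M2 \ W.B,
    ((∃ a n', Edge M1 M2 n (.recv a) n') →
       ∃ e₀ es, EG (some (q, n)) = .sil e₀ es ∧
         ∀ e, e ∈ e₀ :: es ↔ ∃ a n', Edge M1 M2 n (.recv a) n' ∧
           e = .var (some (q, W.tr n'))) ∧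
    ((¬ ∃ a n', Edge M1 M2 n (.recv a) n') → (∃ a n', Edge M1 M2 n (.send a) n') →
       ∃ e₀ es, EG (some (q, n)) = .sil e₀ es ∧
         ∀ e, e ∈ e₀ :: es ↔ ∃ a n', Edge M1 M2 n (.send a) n' ∧
           ∃ U, InTree M2 q U ∧
             ToExpr (fun qi e' => ∃ q', M2.trans qi (.send a) q' ∧
               e' = .var (some (q', W.tr n'))) U e)

/-- Specification of the system `𝒢'` of condition (3b) of the witness-subtree
definition: variables are `Y_n`. -/
def G'Spec (M1 : Machine A P) (M2 : Machine A Q) (W : SubtreeData A P Q)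
    (EG' : SNode A P Q → ITExpr A (SNode A P Q)) : Prop :=
  ∀ n ∈ W.nodes M1 M2 \ W.B,
    ((∃ a n', Edge M1 M2 n (.send a) n') →
       ∃ e₀ es, EG' n = .sil e₀ es ∧
         ∀ e, e ∈ e₀ :: es ↔ ∃ a n', Edge M1 M2 n (.send a) n' ∧ e = .var (W.tr n')) ∧
    ((∃ a n', Edge M1 M2 n (.recv a) n') →
       ∃ (dom : Finset A) (hne : dom.Nonempty) (g : (a : A) → a ∈ dom → ITExpr A (SNode A P Q)),
         EG' n = .inp dom hne g ∧
         (↑dom : Set A) = {a | ∃ n', Edge M1 M2 n (.recv a) n'} ∧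
         ∀ a (h : a ∈ dom), ∀ n', Edge M1 M2 n (.recv a) n' → g a h = .var (W.tr n'))

/-- `(r,B,anc)` is a witness subtree of `simtree(M₁,M₂)`. -/
def SubtreeData.IsWitness (W : SubtreeData A P Q)
    (M1 : Machine A P) (M2 : Machine A Q) : Prop :=
  W.IsCandidate M1 M2 ∧
  -- (1) at least one receive action between an ancestor and its boundary node
  (∀ n ∈ W.B, ∀ ψ, EdgePath M1 M2 (W.anc n) ψ n → 0 < (rcvWord ψ).length) ∧
  -- (2) conditions (2a) and (2b)
  (∀ n ∈ W.anc '' W.B, ∀ n' ∈ W.anc '' W.B ∪ W.B, ∀ ψ, EdgePath M1 M2 n ψ n' →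
    (∀ q ∈ (n.2.2).leaves,
        ∃ t, AccTree M2 (sndWord ψ) q t ∧ t.leaves ⊆ (n'.2.2).leaves) ∧
    (n' ∈ W.B →
        ∃ m, MinAcc M2 ψ ((n.2.2).minHeight) ((n.2.2).leaves) m ∧
          (n.2.2).minHeight ≤ m)) ∧
  -- (3) compatibility of the two systems of input tree equations
  (∃ EG EG', GSpec M1 M2 W EG ∧ G'Spec M1 M2 W EG' ∧
      Compat EG EG' (ITExpr.var none) (ITExpr.var W.r))


theorem ReplaceLeaves.functional {R : S → ITree A S → Prop}
    {T T₁ : ITree A S} (h₁ : ReplaceLeaves R T T₁) :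
    ∀ {R' : S → ITree A S → Prop}, (∀ q t t', R q t → R' q t' → t = t') →
    ∀ {T₂ : ITree A S}, ReplaceLeaves R' T T₂ → T₁ = T₂ := by
  induction h₁ with
  | leaf h =>
    intro R' hR T₂ h₂
    cases h₂ with
    | leaf h' => exact hR _ _ _ h h'
  | node h ih =>
    intro R' hR T₂ h₂
    cases h₂ with
    | node h' =>
      congr 1
      funext a ha
      exact ih a ha hR (h' a ha)

theorem InTree.functional {M : Machine A S} {q : S} {T₁ : ITree A S} (h₁ : InTree M q T₁) :
    ∀ {T₂ : ITree A S}, InTree M q T₂ → T₁ = T₂ := by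
  induction h₁ with
  | leaf h =>
    intro T₂ h₂
    cases h₂ with
    | leaf _ => rfl
    | @node _ dom hne f hd _ =>
      exfalso
      obtain ⟨a, ha⟩ := hne
      have : a ∈ (↑dom : Set A) := ha
      rw [hd, h] at this
      exact this
  | @node q dom hne f hd hf ih =>
    intro T₂ h₂
    cases h₂ with
    | leaf h =>
      exfalso
      obtain ⟨a, ha⟩ := hne
      have : a ∈ (↑dom : Set A) := ha
      rw [hd, h] at this
      exact this
    | @node _ dom' hne' f' hd' hf' =>
      have hdd : dom = dom' := Finset.coe_injective (hd.trans hd'.symm)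
      subst hdd
      congr 1
      funext a ha
      have : a ∈ (↑dom : Set A) := ha
      rw [hd] at this
      obtain ⟨q', hq'⟩ := this
      exact ih a ha q' hq' (hf' a ha q' hq')

theorem ReplaceLeaves.exists_of_leaf {R : S → ITree A S → Prop}
    {T T₁ : ITree A S} (h₁ : ReplaceLeaves R T T₁) : ∀ q ∈ T.leaves, ∃ t, R q t := by
  induction h₁ with
  | leaf h =>
    intro q hq
    simp only [ITree.leaves, Set.mem_singleton_iff] at hq
    subst hq
    exact ⟨_, h⟩
  | node h ih =>
    intro q hq
    simp only [ITree.leaves, Set.mem_setOf_eq] at hq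
    obtain ⟨a, ha, hq⟩ := hq
    exact ih a ha q hq

theorem ReplaceLeaves.mono {R R' : S → ITree A S → Prop}
    {T T₁ : ITree A S} (h₁ : ReplaceLeaves R T T₁) :
    (∀ q ∈ T.leaves, ∀ t, R q t → R' q t) → ReplaceLeaves R' T T₁ := by
  induction h₁ with
  | leaf h =>
    intro H
    exact .leaf (H _ (by simp [ITree.leaves]) _ h)
  | node h ih =>
    intro H
    refine .node fun a ha => ih a ha fun q hq => H q ?_
    simp only [ITree.leaves, Set.mem_setOf_eq]
    exact ⟨a, ha, hq⟩

theorem Machine.sending_of (M : Machine A S) {q q' : S} {a : A}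
    (h : M.trans q (.send a) q') : M.Sending q :=
  ⟨fun hf => hf _ _ h, fun _ _ h' => M.directed _ _ _ _ _ h' h⟩

theorem Machine.receiving_of (M : Machine A S) {q q' : S} {a : A}
    (h : M.trans q (.recv a) q') : M.Receiving q :=
  ⟨fun hf => hf _ _ h, fun _ _ h' => M.directed _ _ _ _ _ h' h⟩

theorem Machine.sending_inSet (M : Machine A S) {q : S}
    (h : M.Sending q) : M.inSet q = ∅ := by
  ext a
  simp only [Machine.inSet, Set.mem_setOf_eq, Set.mem_empty_iff_false, iff_false]
  rintro ⟨q', hq'⟩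
  have := h.2 _ _ hq'
  simp [Act.dir] at this

theorem step_preserves {M1 : Machine A P} {M2 : Machine A Q}
    {R : P → ITree A Q → Prop} (hR : IsSubtypingRel M1 M2 R)
    {c : P × ITree A Q} {ℓ : Act A} {c' : P × ITree A Q}
    (hs : Step M1 M2 c ℓ c') (hc : R c.1 c.2) : R c'.1 c'.2 := by
  cases hs with
  | inp h1 h2 h3 =>
    obtain ⟨p'', hp, hr⟩ :=
      (((hR _ _ hc).2.1 (M1.receiving_of h1)).1 _ rfl).2 _ _ h2
    rw [M1.deterministic _ _ _ _ h1 hp]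
    exact hr
  | out h1 h2 h3 =>
    obtain ⟨q'', hq, hr⟩ :=
      ((hR _ _ hc).2.2 (M1.sending_of h1)).1 _ rfl (M2.sending_of h2) _ _ h1
    rw [M2.deterministic _ _ _ _ h2 hq]
    exact hr
  | inCtx h h1 h2 =>
    obtain ⟨p'', hp, hr⟩ :=
      ((hR _ _ hc).2.1 (M1.receiving_of h1)).2 _ _ _ rfl _ h
    rw [M1.deterministic _ _ _ _ h1 hp]
    exact hr
  | @outAcc p a p' T T' h1 h2 h3 =>
    have hs := (hR _ _ hc).2.2 (M1.sending_of h1)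
    by_cases hT : ∃ q, T = ITree.leaf q ∧ M2.Sending q
    · obtain ⟨q, rfl, hq⟩ := hT
      obtain ⟨q'', hq'', hr⟩ := hs.1 q rfl hq _ _ h1
      cases h3 with
      | leaf h =>
        obtain ⟨U, hU, hUt⟩ := h
        have : ITree.leaf q = U :=
          (InTree.leaf (M2.sending_inSet hq)).functional hU
        subst this
        cases hUt with
        | leaf h =>
          obtain ⟨_, q₁, hq₁, rfl⟩ := h
          rw [M2.deterministic _ _ _ _ hq₁ hq'']
          exact hr
    · obtain ⟨T₂, hT₂, hr⟩ := (hs.2 hT).2.2 _ _ h1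
      have : T' = T₂ := by
        refine h3.functional ?_ hT₂
        rintro q t t' ⟨U, hU, ht⟩ ⟨U', hU', ht'⟩
        have := hU.functional hU'
        subst this
        refine ht.functional ?_ ht'
        rintro q t t' ⟨_, q₁, hq₁, rfl⟩ ⟨q₂, hq₂, rfl⟩
        rw [M2.deterministic _ _ _ _ hq₁ hq₂]
      subst this
      exact hr

theorem progress {M1 : Machine A P} {M2 : Machine A Q}
    {R : P → ITree A Q → Prop} (hR : IsSubtypingRel M1 M2 R)
    (p : P) (T : ITree A Q) (hc : R p T) :
    SuccessfulConfig M1 M2 (p, T) ∨ ∃ ℓ c', Step M1 M2 (p, T) ℓ c' := by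
  by_cases hp : M1.Final p
  · obtain ⟨q, rfl, hq⟩ := (hR _ _ hc).1 hp
    exact .inl ⟨p, q, rfl, hp, hq⟩
  · right
    have hp' := hp
    simp only [Machine.Final, not_forall, not_not] at hp'
    obtain ⟨ℓ, p', htr⟩ := hp'
    cases ℓ with
    | recv a =>
      have hs := (hR _ _ hc).2.1 (M1.receiving_of htr)
      cases T with
      | leaf q =>
        obtain ⟨hq, hrr⟩ := hs.1 q rfl
        have hq' := hq.1
        simp only [Machine.Final, not_forall, not_not] at hq'
        obtain ⟨ℓ, q', hq'⟩ := hq'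
        cases ℓ with
        | send b =>
          have := hq.2 _ _ hq'
          simp [Act.dir] at this
        | recv b =>
          obtain ⟨p₁, hp₁, _⟩ := hrr _ _ hq'
          refine ⟨_, _, Step.inp hp₁ hq' ?_⟩
          rintro x ⟨q₂, hq₂⟩
          obtain ⟨p₂, hp₂, _⟩ := hrr _ _ hq₂
          exact ⟨p₂, hp₂⟩
      | node dom hne f =>
        have hrr := hs.2 dom hne f rfl
        have hne' := hne
        obtain ⟨b, hb⟩ := hne'
        obtain ⟨p₁, hp₁, _⟩ := hrr b hb
        refine ⟨_, _, Step.inCtx hb hp₁ ?_⟩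
        intro x hx
        obtain ⟨p₂, hp₂, _⟩ := hrr x hx
        exact ⟨p₂, hp₂⟩
    | send a =>
      have hs := (hR _ _ hc).2.2 (M1.sending_of htr)
      by_cases hT : ∃ q, T = ITree.leaf q ∧ M2.Sending q
      · obtain ⟨q, rfl, hq⟩ := hT
        have hrr := hs.1 q rfl hq
        obtain ⟨q', hq', _⟩ := hrr _ _ htr
        refine ⟨_, _, Step.out htr hq' ?_⟩
        rintro x ⟨p₂, hp₂⟩
        obtain ⟨q₂, hq₂, _⟩ := hrr _ _ hp₂
        exact ⟨q₂, hq₂⟩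
      · obtain ⟨hcyc, _, hrr⟩ := hs.2 hT
        obtain ⟨T', hT', _⟩ := hrr _ _ htr
        refine ⟨_, _, Step.outAcc (T' := T') htr hcyc (hT'.mono ?_)⟩
        rintro q hq t ⟨U, hU, ht⟩
        refine ⟨U, hU, ht.mono ?_⟩
        rintro qh hqh t' ht'
        refine ⟨?_, ht'⟩
        rintro x ⟨p₂, hp₂⟩
        obtain ⟨T₂, hT₂, _⟩ := hrr _ _ hp₂
        obtain ⟨t₂, U₂, hU₂, ht₂⟩ := hT₂.exists_of_leaf q hq
        have := hU.functional hU₂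
        subst this
        obtain ⟨_, q₂, hq₂, _⟩ := ht₂.exists_of_leaf qh hqh
        exact ⟨q₂, hq₂⟩

/-- If `ℛ` is an asynchronous subtyping relation containing the
pair of initial states, then every node label of `simtree(M₁,M₂)` is in `ℛ`;
consequently every node is a successful leaf or has a successor, and no branch
is unsuccessful. -/
theorem simtree_labels_in_subtyping_rel
    {A P Q : Type} [Fintype A] [Fintype P] [Fintype Q]
    (M1 : Machine A P) (M2 : Machine A Q)
    (R : P → ITree A Q → Prop)
    (hR : IsSubtypingRel M1 M2 R)
    (hinit : R M1.init (ITree.leaf M2.init)) :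
    (∀ p T, CReach M1 M2 (p, T) → R p T) ∧
    (∀ c, CReach M1 M2 c →
        SuccessfulConfig M1 M2 c ∨ ∃ ℓ c', Step M1 M2 c ℓ c') ∧
    AllBranchesSuccessful M1 M2 := by
  have key : ∀ c, CReach M1 M2 c → R c.1 c.2 := by
    intro c hc
    induction hc with
    | refl => exact hinit
    | tail _ hs ih =>
      obtain ⟨ℓ, hs⟩ := hs
      exact step_preserves hR hs ih
  have prog : ∀ c, CReach M1 M2 c →
      SuccessfulConfig M1 M2 c ∨ ∃ ℓ c', Step M1 M2 c ℓ c' :=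
    fun c hc => progress hR c.1 c.2 (key c hc)
  refine ⟨fun p T h => key _ h, prog, ?_⟩
  intro c hc hno
  rcases prog c hc with h | ⟨ℓ, c', h⟩
  · exact h
  · exact absurd h (hno ℓ c')


end AsyncSession
end

section
/- Let M₁ = (P,p₀,δ₁) and M₂ = (Q,q₀,δ₂) be two communicating machines, and let n₀ ↝ n₁ ↝ n₂ ↝ ⋯ be an infinite path in simtree(M₁,M₂). For each index i, let S_i = (p_i, R_i) where ℒ(n_i) = (p_i, 𝒜_i[q_j]^{j∈J_i}) and R_i = {q_j | j∈J_i}. Then there exist a pair (p,R) ∈ P × 𝒫(Q), a single action sequence α ∈ Act*, and infinitely many pairs of indices (v₁,v'₁), (v₂,v'₂), … with v_j < v'_j < v_{j+1} for all j, such that for every j the path from n_{v_j} to n_{v'_j} carries the label sequence α and S_{v_j} = S_{v'_j} = (p,R). -/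
namespace AsyncSession

variable {A P Q S V W' : Type}

theorem finite_act (A : Type) [Finite A] : Finite (Act A) := by
  refine Finite.of_injective (β := A ⊕ A)
    (fun x => match x with | .send a => Sum.inl a | .recv a => Sum.inr a) ?_
  intro x y h
  cases x <;> cases y <;> simp_all

theorem pigeon_pairs {X Y : Type} [Finite X] [Finite Y] (s : ℕ → X) (l : ℕ → Y) :
    ∃ (x : X) (α : List Y) (V V' : ℕ → ℕ), ∀ j : ℕ,
      V j < V' j ∧ V' j < V (j + 1) ∧
      (List.range (V' j - V j)).map (fun m => l (V j + m)) = α ∧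
      s (V j) = x ∧ s (V' j) = x := by
  classical
  have := Fintype.ofFinite X
  set N := Fintype.card X with hN
  have key : ∀ t : ℕ, ∃ ab : Fin (N + 1) × Fin (N + 1), ab.1 < ab.2 ∧
      s (t * (N + 1) + ab.1) = s (t * (N + 1) + ab.2) := by
    intro t
    obtain ⟨a, b, hne, hab⟩ := Fintype.exists_ne_map_eq_of_card_lt
      (fun m : Fin (N + 1) => s (t * (N + 1) + m)) (by simp [hN])
    rcases lt_or_gt_of_ne hne with h | h
    · exact ⟨(a, b), h, hab⟩
    · exact ⟨(b, a), h, hab.symm⟩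
  choose ab hlt heq using key
  obtain ⟨⟨⟨a, b⟩, x, w⟩, hy⟩ := Finite.exists_infinite_fiber
    (fun t : ℕ => ((ab t, s (t * (N + 1) + (ab t).1),
      fun m : Fin (N + 1) => l (t * (N + 1) + m)) :
      (Fin (N + 1) × Fin (N + 1)) × X × (Fin (N + 1) → Y)))
  have hinf := Set.infinite_coe_iff.mp hy
  obtain ⟨K, hKm, hKmem⟩ : ∃ K : ℕ → ℕ, StrictMono K ∧ ∀ j,
      (ab (K j), s (K j * (N + 1) + (ab (K j)).1),
      fun m : Fin (N + 1) => l (K j * (N + 1) + m)) = ((a, b), x, w) :=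
    ⟨Nat.nth _, Nat.nth_strictMono hinf, fun j => Nat.nth_mem_of_infinite hinf j⟩
  have hmem : ∀ j, ab (K j) = (a, b) ∧ s (K j * (N + 1) + (ab (K j)).1) = x ∧
      (fun m : Fin (N + 1) => l (K j * (N + 1) + m)) = w := by
    intro j
    have h : (ab (K j), s (K j * (N + 1) + (ab (K j)).1),
      fun m : Fin (N + 1) => l (K j * (N + 1) + m)) = ((a, b), x, w) := hKmem j
    exact ⟨congrArg Prod.fst h, congrArg (fun z => z.2.1) h, congrArg (fun z => z.2.2) h⟩
  have hab : a < b := by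
    have := hlt (K 0)
    rw [(hmem 0).1] at this
    exact this
  have hw : ∀ j (m : ℕ) (h : m < N + 1), l (K j * (N + 1) + m) = w ⟨m, h⟩ := by
    intro j m h
    rw [← (hmem j).2.2]
  have hab' : (a : ℕ) < b := hab
  have hb := b.2
  refine ⟨x, (List.range (b - a : ℕ)).map (fun m => l (K 0 * (N + 1) + a + m)),
    fun j => K j * (N + 1) + a, fun j => K j * (N + 1) + b, fun j => ⟨?_, ?_, ?_, ?_, ?_⟩⟩
  · simpa using hab
  · have h1 : K j + 1 ≤ K (j + 1) := hKm (Nat.lt_succ_self j)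
    have h2 := Nat.mul_le_mul_right (N + 1) h1
    rw [Nat.add_mul] at h2
    show K j * (N + 1) + (b : ℕ) < K (j + 1) * (N + 1) + a
    omega
  · have e : K j * (N + 1) + (b : ℕ) - (K j * (N + 1) + a) = b - a := by omega
    simp only [e]
    apply List.map_congr_left
    intro m hm
    rw [List.mem_range] at hm
    rw [add_assoc, add_assoc, hw j _ (by omega), hw 0 _ (by omega)]
  · have := (hmem j).2.1
    rwa [(hmem j).1] at this
  · have h1 := (hmem j).2.1
    have h2 := heq (K j)
    rw [h1, (hmem j).1] at h2
    exact h2.symm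

/-- Along any infinite path of `simtree(M₁,M₂)` there are a pair
`(p,R)`, a single action sequence `α`, and infinitely many ordered disjoint pairs
of indices whose connecting paths all carry the label sequence `α` and whose
endpoints both have `S`-value `(p,R)`. -/
theorem simtree_repeated_label_sequence
    {A P Q : Type} [Fintype A] [Fintype P] [Fintype Q]
    (M1 : Machine A P) (M2 : Machine A Q)
    (c : ℕ → P × ITree A Q) (ℓ : ℕ → Act A)
    (h0 : c 0 = initConfig M1 M2)
    (hstep : ∀ i, Step M1 M2 (c i) (ℓ i) (c (i + 1))) :
    ∃ (p : P) (R : Set Q) (α : List (Act A)) (V V' : ℕ → ℕ), ∀ j : ℕ,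
      V j < V' j ∧ V' j < V (j + 1) ∧
      (List.range (V' j - V j)).map (fun m => ℓ (V j + m)) = α ∧
      (c (V j)).1 = p ∧ ((c (V j)).2).leaves = R ∧
      (c (V' j)).1 = p ∧ ((c (V' j)).2).leaves = R := by
  have := finite_act A
  obtain ⟨⟨p, R⟩, α, V, V', h⟩ :=
    pigeon_pairs (fun i => ((c i).1, ((c i).2).leaves)) ℓ
  refine ⟨p, R, α, V, V', fun j => ?_⟩
  obtain ⟨h1, h2, h3, h4, h5⟩ := h j
  simp only [Prod.mk.injEq] at h4 h5
  exact ⟨h1, h2, h3, h4.1, h4.2, h5.1, h5.2⟩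

end AsyncSession
end
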